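/- (Start of the moving plane method in exterior domains.) In the setting of Theorem 2.3 with fixed direction e ∈ ∂B₁(0), the statement (S_λ) holds for all sufficiently large λ; that is, there exists Λ ∈ ℝ such that v_μ = u − u∘R_{μ,e} > 0 in D_μ = {x·e < μ}∖(G ∪ R_{μ,e}(G)) for every μ ≥ Λ. -/

import Mathlib

open MeasureTheory Set Filter Metric Asymptotics
open scoped RealInnerProductSpace ENNReal Topology NNReal

noncomputable section

abbrev Rd (d : ℕ) := EuclideanSpace ℝ (Fin d)

/-- The data of a Bernstein function `Ψ` vanishing at `0`, its Lévy measure `𝔪`,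
and the weak scaling conditions. -/
structure PsiSetting (d : ℕ) where
  Ψ : ℝ → ℝ
  m : Measure ℝ
  m_onIoi : m (Set.Iic 0) = 0
  smooth : ContDiffOn ℝ (⊤ : ℕ∞) Ψ (Set.Ioi 0)
  nonneg : ∀ x > (0:ℝ), 0 ≤ Ψ x
  deriv_alt : ∀ n : ℕ, ∀ x > (0:ℝ),
    (-1 : ℝ) ^ (n + 1) * iteratedDerivWithin (n + 1) Ψ (Set.Ioi 0) x ≤ 0
  zero_lim : Filter.Tendsto Ψ (nhdsWithin 0 (Set.Ioi 0)) (nhds 0)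
  levy_rep : ∀ lam > (0:ℝ), Ψ lam = ∫ t, (1 - Real.exp (-lam * t)) ∂m
  a₁ : ℝ
  a₂ : ℝ
  b₁ : ℝ
  b₂ : ℝ
  ha₁ : 0 < a₁
  ha₁₂ : a₁ ≤ a₂
  ha₂ : a₂ < 1
  hb₁ : 1 ≤ b₁
  hb₂ : 1 < b₂
  scaling_lower : ∀ r R : ℝ, 1 ≤ r → r ≤ R → (1 / b₁) * (R / r) ^ a₁ ≤ Ψ R / Ψ r
  scaling_upper : ∀ r R : ℝ, 1 ≤ r → r ≤ R → Ψ R / Ψ r ≤ b₁ * (R / r) ^ a₂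

/-- The jump kernel `j(r) = ∫_0^∞ (4πt)^{-d/2} e^{-r²/(4t)} 𝔪(dt)`. -/
def PsiSetting.j {d : ℕ} (S : PsiSetting d) (r : ℝ) : ℝ :=
  ∫ t, (4 * Real.pi * t) ^ (-(d : ℝ) / 2) * Real.exp (-(r ^ 2) / (4 * t)) ∂S.m

/-- The condition `j(r) ≤ b₂ j(r+1)` for `r ≥ 1`. -/
def PsiSetting.kernelCond {d : ℕ} (S : PsiSetting d) : Prop :=
  ∀ r : ℝ, 1 ≤ r → S.j r ≤ S.b₂ * S.j (r + 1)

/-- The nonlocal operator `Ψ(−Δ)` applied to a test function. -/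
def psiOp {d : ℕ} (S : PsiSetting d) (φ : Rd d → ℝ) (x : Rd d) : ℝ :=
  ∫ z : Rd d,
    (φ x - φ (x + z) + (if ‖z‖ ≤ 1 then ⟪z, gradient φ x⟫ else 0)) * S.j ‖z‖

/-- Admissible test functions at `x`: bounded continuous and C² near `x`. -/
def TestAt {d : ℕ} (x : Rd d) (φ : Rd d → ℝ) : Prop :=
  (∃ M, ∀ y, |φ y| ≤ M) ∧ Continuous φ ∧ ∃ U ∈ nhds x, ContDiffOn ℝ 2 φ U

/-- Viscosity supersolution of `Ψ(−Δ)u + c·u = g` in `Ω`. -/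
def IsSuperSol {d : ℕ} (S : PsiSetting d) (Ω : Set (Rd d)) (c g u : Rd d → ℝ) : Prop :=
  LowerSemicontinuous u ∧
    ∀ x ∈ Ω, ∀ φ : Rd d → ℝ, TestAt x φ → φ x = u x → (∀ y, y ≠ x → φ y < u y) →
      g x ≤ psiOp S φ x + c x * u x

/-- Viscosity subsolution of `Ψ(−Δ)u + c·u = g` in `Ω`. -/
def IsSubSol {d : ℕ} (S : PsiSetting d) (Ω : Set (Rd d)) (c g u : Rd d → ℝ) : Prop :=
  UpperSemicontinuous u ∧
    ∀ x ∈ Ω, ∀ φ : Rd d → ℝ, TestAt x φ → φ x = u x → (∀ y, y ≠ x → u y < φ y) →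
      psiOp S φ x + c x * u x ≤ g x

/-- Viscosity solution of `Ψ(−Δ)u + c·u = g` in `Ω`. -/
def IsSol {d : ℕ} (S : PsiSetting d) (Ω : Set (Rd d)) (c g u : Rd d → ℝ) : Prop :=
  IsSubSol S Ω c g u ∧ IsSuperSol S Ω c g u

/-- `V` is the renewal function of the ascending ladder-height process associated with `Ψ`. -/
structure IsRenewal (Ψ V : ℝ → ℝ) : Prop where
  nonneg : ∀ x, 0 ≤ V x
  zero : ∀ x ≤ (0:ℝ), V x = 0
  cont : ContinuousOn V (Set.Ioi 0)
  mono : StrictMonoOn V (Set.Ioi 0)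
  laplace : ∀ s : ℝ, 0 < s →
    (∫ x in Set.Ioi (0 : ℝ), V x * Real.exp (-s * x)) =
      1 / (s * Real.exp ((1 / Real.pi) *
        ∫ y in Set.Ioi (0 : ℝ), Real.log (Ψ (s * y)) / (1 + y ^ 2)))

/-- `tr_V(u)(x) = t`: the `V`-trace of `u` at the boundary point `x` of `D`. -/
def HasVTrace {d : ℕ} (V : ℝ → ℝ) (D : Set (Rd d)) (u : Rd d → ℝ)
    (x : Rd d) (t : ℝ) : Prop :=
  Filter.Tendsto (fun z => u z / V (Metric.infDist z Dᶜ)) (nhdsWithin x D) (nhds t)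

/-- An open set has C² boundary. -/
def HasC2Boundary {d : ℕ} (D : Set (Rd d)) : Prop :=
  ∀ x ∈ frontier D, ∃ (U : Set (Rd d)) (f : Rd d → ℝ),
    IsOpen U ∧ x ∈ U ∧ ContDiffOn ℝ 2 f U ∧ (∀ y ∈ U, fderiv ℝ f y ≠ 0) ∧
      D ∩ U = {y ∈ U | f y < 0}

/-- A closed set has C² boundary. -/
def HasC2BoundaryClosed {d : ℕ} (G : Set (Rd d)) : Prop :=
  ∀ x ∈ frontier G, ∃ (U : Set (Rd d)) (f : Rd d → ℝ),
    IsOpen U ∧ x ∈ U ∧ ContDiffOn ℝ 2 f U ∧ (∀ y ∈ U, fderiv ℝ f y ≠ 0) ∧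
      G ∩ U = {y ∈ U | f y ≤ 0}

/-- Reflection `R_{λ,e}` across the hyperplane `{x·e = λ}`. -/
def reflAt {d : ℕ} (e : Rd d) (lam : ℝ) (x : Rd d) : Rd d :=
  x - (2 * ⟪x, e⟫ - 2 * lam) • e

/-- The open half-space `H_{λ,e} = {x·e > λ}`. -/
def halfSpace {d : ℕ} (e : Rd d) (lam : ℝ) : Set (Rd d) := {x | lam < ⟪x, e⟫}

/-- A function is antisymmetric with respect to the half-space `H_{λ,e}`. -/
def AntiSym {d : ℕ} (e : Rd d) (lam : ℝ) (u : Rd d → ℝ) : Prop :=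
  ∀ x, u x = - u (reflAt e lam x)

/-- The hyperplane `{x·e = λ}` is orthogonal to `∂G` at `p` (expressed through
a local C² defining function of `G` near `p`). -/
def OrthAt {d : ℕ} (G : Set (Rd d)) (e p : Rd d) : Prop :=
  ∃ (U : Set (Rd d)) (f : Rd d → ℝ), IsOpen U ∧ p ∈ U ∧ ContDiffOn ℝ 2 f U ∧
    fderiv ℝ f p ≠ 0 ∧ G ∩ U = {y ∈ U | f y ≤ 0} ∧ fderiv ℝ f p e = 0

/-- Situation 1: a touching point `p₀ ∈ ∂G ∩ ∂R_{λ,e}(G ∩ H_{λ,e})` away from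
the hyperplane `{x·e = λ}`. -/
def Sit1 {d : ℕ} (G : Set (Rd d)) (e : Rd d) (lam : ℝ) : Prop :=
  ∃ p, p ∈ frontier G ∧
    p ∈ frontier (reflAt e lam '' (G ∩ halfSpace e lam)) ∧ ⟪p, e⟫ ≠ lam

/-- Situation 2: the hyperplane `{x·e = λ}` is orthogonal to `∂G` at some
point `p₀ ∈ ∂G ∩ {x·e = λ}`. -/
def Sit2 {d : ℕ} (G : Set (Rd d)) (e : Rd d) (lam : ℝ) : Prop :=
  ∃ p, p ∈ frontier G ∧ ⟪p, e⟫ = lam ∧ OrthAt G e p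

/-! ### The jump kernel -/

namespace PsiSetting

variable {d : ℕ} (S : PsiSetting d)

lemma integrable_one_sub_exp : Integrable (fun t : ℝ => 1 - Real.exp (-t)) S.m := by
  by_contra h
  have h1 : S.Ψ 1 = 0 := by
    rw [S.levy_rep 1 one_pos]
    apply integral_undef
    simpa using h
  have h2 := S.scaling_lower 1 1 le_rfl le_rfl
  have h3 := S.hb₁
  simp [h1] at h2
  linarith

lemma ae_pos : ∀ᵐ t ∂S.m, 0 < t := by
  have := S.m_onIoi
  rw [ae_iff]
  convert this using 2
  ext t
  simp

lemma sigmaFinite : SigmaFinite S.m := by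
  have hf := S.integrable_one_sub_exp.aefinStronglyMeasurable
  have h := hf.ae_eq_zero_compl
  have h2 := (ae_restrict_iff' hf.measurableSet.compl).1 h
  have h3 : ∀ᵐ t ∂S.m, t ∈ hf.sigmaFiniteSet := by
    filter_upwards [h2, S.ae_pos] with t ht htpos
    by_contra hc
    have := ht hc
    have h4 : Real.exp (-t) < 1 := by simpa using htpos
    simp at this
    linarith
  rw [← Measure.restrict_eq_self_of_ae_mem h3]
  infer_instance

lemma measure_ne_zero : S.m ≠ 0 := by
  intro h
  have h1 : S.Ψ 1 = 0 := by
    rw [S.levy_rep 1 one_pos, h]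
    simp
  have h2 := S.scaling_lower 1 1 le_rfl le_rfl
  have h3 := S.hb₁
  simp [h1] at h2
  linarith

/-- The integrand defining the jump kernel, i.e. the heat kernel. -/
def heat (d : ℕ) (t r : ℝ) : ℝ :=
  (4 * Real.pi * t) ^ (-(d : ℝ) / 2) * Real.exp (-(r ^ 2) / (4 * t))

lemma heat_pos {t : ℝ} (ht : 0 < t) (r : ℝ) : 0 < heat d t r := by
  unfold heat
  have := Real.pi_pos
  positivity

lemma heat_strictAnti {t r s : ℝ} (ht : 0 < t) (hr : 0 ≤ r) (hrs : r < s) :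
    heat d t s < heat d t r := by
  unfold heat
  have := Real.pi_pos
  gcongr

lemma measurable_heat : Measurable (fun p : ℝ × Rd d => heat d p.1 ‖p.2‖) := by
  unfold heat
  fun_prop

lemma heat_eq (t : ℝ) (z : Rd d) :
    heat d t ‖z‖ = (4 * Real.pi * t) ^ (-(d : ℝ) / 2) * Real.exp (-(1 / (4 * t)) * ‖z‖ ^ 2) := by
  unfold heat
  congr 2
  ring

lemma integrable_exp_neg_mul_sq_norm {b : ℝ} (hb : 0 < b) :
    Integrable (fun z : Rd d => Real.exp (-b * ‖z‖ ^ 2)) := by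
  by_contra h
  have h1 := GaussianFourier.integral_rexp_neg_mul_sq_norm (V := Rd d) hb
  rw [integral_undef h] at h1
  have : 0 < (Real.pi / b) ^ (Module.finrank ℝ (Rd d) / 2 : ℝ) := by
    have := Real.pi_pos
    positivity
  linarith

lemma integrable_heat {t : ℝ} (ht : 0 < t) : Integrable (fun z : Rd d => heat d t ‖z‖) := by
  simp_rw [heat_eq]
  exact (integrable_exp_neg_mul_sq_norm (by positivity)).const_mul _

lemma integral_heat {t : ℝ} (ht : 0 < t) : ∫ z : Rd d, heat d t ‖z‖ = 1 := by
  have := Real.pi_pos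
  simp_rw [heat_eq, integral_const_mul]
  rw [GaussianFourier.integral_rexp_neg_mul_sq_norm (by positivity), finrank_euclideanSpace_fin]
  have : Real.pi / (1 / (4 * t)) = 4 * Real.pi * t := by
    field_simp
  rw [this, ← Real.rpow_add (by positivity)]
  ring_nf
  exact Real.rpow_zero _

lemma sq_mul_heat_le {t : ℝ} (ht : 0 < t) (z : Rd d) :
    ‖z‖ ^ 2 * heat d t ‖z‖ ≤ 8 * t * (2 : ℝ) ^ ((d : ℝ) / 2) * heat d (2 * t) ‖z‖ := by
  have hpi := Real.pi_pos
  rw [heat_eq, heat_eq]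
  have h1 : (4 * Real.pi * (2 * t)) ^ (-(d : ℝ) / 2) =
      (4 * Real.pi * t) ^ (-(d : ℝ) / 2) * (2 : ℝ) ^ (-(d : ℝ) / 2) := by
    rw [← Real.mul_rpow (by positivity) (by positivity)]
    ring_nf
  have h2 : (2 : ℝ) ^ ((d : ℝ) / 2) * (2 : ℝ) ^ (-(d : ℝ) / 2) = 1 := by
    rw [← Real.rpow_add (by positivity)]
    ring_nf
    exact Real.rpow_zero _
  set s := ‖z‖ ^ 2 with hs
  have h3 : s ≤ 8 * t * Real.exp (s / (8 * t)) := by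
    have := Real.add_one_le_exp (s / (8 * t))
    have h4 : s = 8 * t * (s / (8 * t)) := by field_simp
    calc s = 8 * t * (s / (8 * t)) := h4
      _ ≤ 8 * t * Real.exp (s / (8 * t)) := by gcongr; linarith
  have h5 : Real.exp (-(1 / (4 * (2 * t))) * s) =
      Real.exp (s / (8 * t)) * Real.exp (-(1 / (4 * t)) * s) := by
    rw [← Real.exp_add]
    congr 1
    field_simp
    ring
  rw [h1, h5]
  calc s * ((4 * Real.pi * t) ^ (-(d : ℝ) / 2) * Real.exp (-(1 / (4 * t)) * s))
      ≤ 8 * t * Real.exp (s / (8 * t)) *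
        ((4 * Real.pi * t) ^ (-(d : ℝ) / 2) * Real.exp (-(1 / (4 * t)) * s)) := by gcongr
    _ = 8 * t * Real.exp (s / (8 * t)) *
        ((4 * Real.pi * t) ^ (-(d : ℝ) / 2) * Real.exp (-(1 / (4 * t)) * s)) *
        ((2 : ℝ) ^ ((d : ℝ) / 2) * (2 : ℝ) ^ (-(d : ℝ) / 2)) := by rw [h2, mul_one]
    _ = _ := by ring

lemma integrable_min_mul_heat {t : ℝ} (ht : 0 < t) :
    Integrable (fun z : Rd d => min 1 (‖z‖ ^ 2) * heat d t ‖z‖) := by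
  refine (integrable_heat (d := d) ht).mono' ?_ ?_
  · refine Measurable.aestronglyMeasurable ?_
    unfold heat
    fun_prop
  · filter_upwards with z
    have := (heat_pos (d := d) ht ‖z‖).le
    rw [Real.norm_of_nonneg (by positivity)]
    exact mul_le_of_le_one_left this (min_le_left _ _)

lemma integral_min_mul_heat_le {t : ℝ} (ht : 0 < t) :
    ∫ z : Rd d, min 1 (‖z‖ ^ 2) * heat d t ‖z‖ ≤
      (8 * (2 : ℝ) ^ ((d : ℝ) / 2) + 1) * (1 - Real.exp (-t)) := by
  have hI := integrable_min_mul_heat (d := d) ht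
  set I := ∫ z : Rd d, min 1 (‖z‖ ^ 2) * heat d t ‖z‖
  set C := 8 * (2 : ℝ) ^ ((d : ℝ) / 2) with hC
  have hCpos : 0 < C := by positivity
  have h1 : I ≤ 1 := by
    rw [← integral_heat (d := d) ht]
    refine integral_mono hI (integrable_heat ht) fun z => ?_
    exact mul_le_of_le_one_left (heat_pos ht _).le (min_le_left _ _)
  have h2 : I ≤ C * t := by
    have h2t : 0 < 2 * t := by positivity
    calc I ≤ ∫ z : Rd d, 8 * t * (2 : ℝ) ^ ((d : ℝ) / 2) * heat d (2 * t) ‖z‖ := by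
          refine integral_mono hI ((integrable_heat h2t).const_mul _) fun z => ?_
          refine le_trans ?_ (sq_mul_heat_le ht z)
          exact mul_le_mul_of_nonneg_right (min_le_right _ _) (heat_pos ht _).le
      _ = C * t := by rw [integral_const_mul, integral_heat h2t, hC]; ring
  have h3 : t / (1 + t) ≤ 1 - Real.exp (-t) := by
    have h4 : Real.exp (-t) ≤ 1 / (1 + t) := by
      rw [Real.exp_neg, ← one_div]
      apply one_div_le_one_div_of_le (by positivity)
      linarith [Real.add_one_le_exp t]
    have : t / (1 + t) = 1 - 1 / (1 + t) := by field_simp; ring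
    linarith
  have h5 : I ≤ (C + 1) * (t / (1 + t)) := by
    rw [mul_div_assoc', le_div_iff₀ (by positivity)]
    nlinarith
  exact h5.trans (by gcongr)

lemma integrable_prod :
    Integrable (fun p : ℝ × Rd d => min 1 (‖p.2‖ ^ 2) * heat d p.1 ‖p.2‖)
      (S.m.prod volume) := by
  have := S.sigmaFinite
  have hm : Measurable (fun p : ℝ × Rd d => min 1 (‖p.2‖ ^ 2) * heat d p.1 ‖p.2‖) :=
    Measurable.mul (by fun_prop) measurable_heat
  rw [integrable_prod_iff hm.aestronglyMeasurable]
  constructor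
  · filter_upwards [S.ae_pos] with t ht using integrable_min_mul_heat ht
  · refine (S.integrable_one_sub_exp.const_mul (8 * (2 : ℝ) ^ ((d : ℝ) / 2) + 1)).mono' ?_ ?_
    · exact hm.norm.stronglyMeasurable.integral_prod_right'.aestronglyMeasurable
    · filter_upwards [S.ae_pos] with t ht
      have h0 : 0 ≤ ∫ y : Rd d, ‖min 1 (‖y‖ ^ 2) * heat d t ‖y‖‖ :=
        integral_nonneg fun _ => norm_nonneg _
      rw [Real.norm_of_nonneg h0]
      refine le_trans (le_of_eq ?_) (integral_min_mul_heat_le ht)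
      refine integral_congr_ae (ae_of_all _ fun z => ?_)
      have := (heat_pos (d := d) ht ‖z‖).le
      exact Real.norm_of_nonneg (by positivity)

lemma integrable_min_mul_j :
    Integrable (fun z : Rd d => min 1 (‖z‖ ^ 2) * S.j ‖z‖) := by
  have := S.sigmaFinite
  have h := S.integrable_prod.integral_prod_right
  refine h.congr (ae_of_all _ fun z => ?_)
  exact integral_const_mul (min 1 (‖z‖ ^ 2)) (fun t => heat d t ‖z‖)

lemma measurable_j : Measurable (fun z : Rd d => S.j ‖z‖) := by
  have := S.sigmaFinite
  exact (measurable_heat (d := d)).stronglyMeasurable.integral_prod_left'.measurable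

lemma j_nonneg (r : ℝ) : 0 ≤ S.j r := by
  refine integral_nonneg_of_ae ?_
  filter_upwards [S.ae_pos] with t ht using (heat_pos ht r).le

lemma integrable_heat_time (hd : 2 ≤ d) {r : ℝ} (hr : 0 < r) :
    Integrable (fun t => heat d t r) S.m := by
  have := S.sigmaFinite
  have h := S.integrable_prod.prod_left_ae
  have hne : Nonempty (Fin d) := ⟨⟨0, by omega⟩⟩
  have hset : (volume : Measure (Rd d)) (ball 0 r \ {0}) ≠ 0 := by
    rw [measure_sdiff_null (measure_singleton _)]
    exact (measure_ball_pos _ _ hr).ne'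
  obtain ⟨z, hz, hzi⟩ : ∃ z ∈ ball (0 : Rd d) r \ {0},
      Integrable (fun t => min 1 (‖z‖ ^ 2) * heat d t ‖z‖) S.m := by
    by_contra hcon
    push Not at hcon
    apply hset
    refine measure_mono_null ?_ (ae_iff.1 h)
    intro z hz
    exact hcon z hz
  have hz0 : 0 < ‖z‖ := norm_pos_iff.2 hz.2
  have hc : 0 < min 1 (‖z‖ ^ 2) := by positivity
  have h1 : Integrable (fun t => heat d t ‖z‖) S.m := by
    refine (hzi.const_mul (min 1 (‖z‖ ^ 2))⁻¹).congr (ae_of_all _ fun t => ?_)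
    simp only
    rw [inv_mul_cancel_left₀ hc.ne']
  refine h1.mono' ?_ ?_
  · refine Measurable.aestronglyMeasurable ?_
    unfold heat
    fun_prop
  · filter_upwards [S.ae_pos] with t ht
    rw [Real.norm_of_nonneg (heat_pos ht r).le]
    exact (heat_strictAnti ht (norm_nonneg _) (by simpa using hz.1)).le

lemma j_strictAnti (hd : 2 ≤ d) {r s : ℝ} (hr : 0 < r) (hrs : r < s) : S.j s < S.j r := by
  have hir := S.integrable_heat_time hd hr
  have his := S.integrable_heat_time hd (hr.trans hrs)
  rw [← sub_pos]
  have : S.j r - S.j s = ∫ t, (heat d t r - heat d t s) ∂S.m := (integral_sub hir his).symm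
  rw [this]
  have hpos : ∀ᵐ t ∂S.m, 0 < heat d t r - heat d t s := by
    filter_upwards [S.ae_pos] with t ht using sub_pos.2 (heat_strictAnti ht hr.le hrs)
  rw [integral_pos_iff_support_of_nonneg_ae (hpos.mono fun t ht => ht.le) (hir.sub his)]
  rw [pos_iff_ne_zero]
  intro h0
  apply S.measure_ne_zero
  rw [← ae_eq_bot, ← Filter.eventually_false_iff_eq_bot]
  have h1 : ∀ᵐ t ∂S.m, t ∉ Function.support fun t => heat d t r - heat d t s :=
    measure_eq_zero_iff_ae_notMem.1 h0
  filter_upwards [h1, hpos] with t h2 h3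
  exact h2 h3.ne'

end PsiSetting

/-! ### Second differences and Lévy densities -/

/-- The symmetric second difference of `φ` at `x` in the direction `z`. -/
def secondDiff {d : ℕ} (φ : Rd d → ℝ) (x z : Rd d) : ℝ := 2 * φ x - φ (x + z) - φ (x - z)

/-- A symmetric nonnegative density integrating `min 1 ‖z‖²`. -/
structure IsLevyDensity {d : ℕ} (k : Rd d → ℝ) : Prop where
  nonneg : ∀ z, 0 ≤ k z
  meas : Measurable k
  even : ∀ z, k (-z) = k z
  integrable : Integrable (fun z => min 1 (‖z‖ ^ 2) * k z)

lemma PsiSetting.isLevyDensity {d : ℕ} (S : PsiSetting d) :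
    IsLevyDensity (fun z : Rd d => S.j ‖z‖) where
  nonneg _ := S.j_nonneg _
  meas := S.measurable_j
  even z := by simp
  integrable := S.integrable_min_mul_j

namespace IsLevyDensity

variable {d : ℕ} {k : Rd d → ℝ}

lemma integrable_mul_of_le (hk : IsLevyDensity k) {g : Rd d → ℝ} (hg : Measurable g) {M C δ : ℝ}
    (hδ : 0 < δ) (hM : ∀ z, |g z| ≤ M) (hC : ∀ z, ‖z‖ < δ → |g z| ≤ C * ‖z‖ ^ 2) :
    Integrable (fun z => g z * k z) := by
  have hM0 : 0 ≤ M := (abs_nonneg _).trans (hM 0)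
  set D := M + |C| + M / δ ^ 2 with hD
  have hDM : M ≤ D := by
    have := abs_nonneg C
    have : 0 ≤ M / δ ^ 2 := by positivity
    linarith
  have key : ∀ z, |g z| ≤ D * min 1 (‖z‖ ^ 2) := by
    intro z
    rcases le_total 1 (‖z‖ ^ 2) with h | h
    · rw [min_eq_left h, mul_one]
      exact (hM z).trans hDM
    · rw [min_eq_right h]
      rcases lt_or_ge ‖z‖ δ with h1 | h1
      · refine (hC z h1).trans ?_
        have h2 : C ≤ D := by
          have := le_abs_self C
          have : 0 ≤ M / δ ^ 2 := by positivity
          linarith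
        gcongr
      · refine (hM z).trans ?_
        have h2 : M / δ ^ 2 ≤ D := by
          have := abs_nonneg C
          linarith
        calc M = M / δ ^ 2 * δ ^ 2 := by field_simp
          _ ≤ D * ‖z‖ ^ 2 := by gcongr
  refine (hk.integrable.const_mul D).mono' (hg.mul hk.meas).aestronglyMeasurable ?_
  filter_upwards with z
  rw [norm_mul, Real.norm_eq_abs, Real.norm_of_nonneg (hk.nonneg z), ← mul_assoc]
  exact mul_le_mul_of_nonneg_right (key z) (hk.nonneg z)

lemma integrableOn_compl_ball (hk : IsLevyDensity k) {ρ : ℝ} (hρ : 0 < ρ) :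
    IntegrableOn k (ball 0 ρ)ᶜ := by
  have hc : 0 < min 1 (ρ ^ 2) := by positivity
  refine ((hk.integrable.const_mul (min 1 (ρ ^ 2))⁻¹).integrableOn).mono'
    hk.meas.aestronglyMeasurable ?_
  filter_upwards [ae_restrict_mem measurableSet_ball.compl] with z hz
  have hz' : ρ ≤ ‖z‖ := by simpa using hz
  rw [Real.norm_of_nonneg (hk.nonneg z), ← mul_assoc]
  refine le_mul_of_one_le_left (hk.nonneg z) ?_
  rw [← div_eq_inv_mul, one_le_div hc]
  gcongr

lemma integrableOn_mul (hk : IsLevyDensity k) {ρ : ℝ} (hρ : 0 < ρ) {g : Rd d → ℝ}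
    (hg : Measurable g) {M : ℝ} (hM : ∀ z, |g z| ≤ M) :
    IntegrableOn (fun z => g z * k z) (ball 0 ρ)ᶜ :=
  (hk.integrableOn_compl_ball hρ).bdd_mul hg.aestronglyMeasurable
    (ae_of_all _ fun z => by simpa using hM z)

end IsLevyDensity

section Taylor

variable {d : ℕ}

lemma ContDiffAt.exists_taylor_le {φ : Rd d → ℝ} {x : Rd d} (h : ContDiffAt ℝ 2 φ x) :
    ∃ L : ℝ, ∃ δ > 0, ∀ z, ‖z‖ < δ → |φ (x + z) - φ x - fderiv ℝ φ x z| ≤ L * ‖z‖ ^ 2 := by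
  have hc : ContDiffAt ℝ 1 (fderiv ℝ φ) x := h.fderiv_right (by norm_num)
  obtain ⟨K, t, ht, hL⟩ := hc.exists_lipschitzOnWith
  have hd : ∀ᶠ y in 𝓝 x, DifferentiableAt ℝ φ y :=
    (h.eventually (by simp)).mono fun y hy => hy.differentiableAt (by simp)
  obtain ⟨δ, hδ, hball⟩ := Metric.eventually_nhds_iff_ball.1 (hd.and ht)
  refine ⟨K, δ, hδ, fun z hz => ?_⟩
  have hsub : ∀ y ∈ closedBall x ‖z‖, y ∈ ball x δ := fun y hy =>
    lt_of_le_of_lt hy hz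
  have := (convex_closedBall x ‖z‖).norm_image_sub_le_of_norm_hasFDerivWithin_le'
    (f := φ) (f' := fderiv ℝ φ) (φ := fderiv ℝ φ x) (C := K * ‖z‖) (x := x) (y := x + z)
    (fun y hy => (hball y (hsub y hy)).1.hasFDerivAt.hasFDerivWithinAt)
    (fun y hy => by
      have h1 := hL.dist_le_mul y (hball y (hsub y hy)).2 x (hball x (mem_ball_self hδ)).2
      rw [dist_eq_norm] at h1
      refine h1.trans ?_
      gcongr
      exact hy)
    (mem_closedBall_self (norm_nonneg _)) (by simp)
  simpa [sq, mul_assoc] using this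

lemma TestAt.contDiffAt {φ : Rd d → ℝ} {x : Rd d} (h : TestAt x φ) : ContDiffAt ℝ 2 φ x := by
  obtain ⟨-, -, U, hU, hφ⟩ := h
  exact hφ.contDiffAt hU

lemma TestAt.integrable_psiOp {φ : Rd d → ℝ} {x : Rd d} (S : PsiSetting d) (h : TestAt x φ) :
    Integrable (fun z => (φ x - φ (x + z) + (if ‖z‖ ≤ 1 then ⟪z, gradient φ x⟫ else 0)) *
      S.j ‖z‖) := by
  obtain ⟨L, δ, hδ, hL⟩ := h.contDiffAt.exists_taylor_le
  obtain ⟨M, hM⟩ := h.1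
  have hφ : Measurable φ := h.2.1.measurable
  refine S.isLevyDensity.integrable_mul_of_le (δ := min δ 1) (C := L)
    (M := 2 * M + ‖gradient φ x‖) ?_ (by positivity) ?_ ?_
  · refine Measurable.add (by fun_prop) (Measurable.ite ?_ (by fun_prop) (by fun_prop))
    exact measurableSet_le (by fun_prop) (by fun_prop)
  · intro z
    have h1 : |if ‖z‖ ≤ 1 then ⟪z, gradient φ x⟫ else 0| ≤ ‖gradient φ x‖ := by
      split_ifs with hz
      · refine (abs_real_inner_le_norm _ _).trans ?_
        exact mul_le_of_le_one_left (norm_nonneg _) hz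
      · simp
    have h2 := abs_le.1 (hM x)
    have h3 := abs_le.1 (hM (x + z))
    have h4 := abs_le.1 h1
    rw [abs_le]
    constructor <;> linarith
  · intro z hz
    have hz1 : ‖z‖ ≤ 1 := (hz.trans_le (min_le_right _ _)).le
    have h1 := hL z (hz.trans_le (min_le_left _ _))
    have h2 : ⟪z, gradient φ x⟫ = fderiv ℝ φ x z := by
      rw [real_inner_comm, gradient, InnerProductSpace.toDual_symm_apply]
    rw [if_pos hz1, h2, abs_sub_comm] at *
    convert h1 using 2
    ring

lemma TestAt.integrable_secondDiff {φ : Rd d → ℝ} {x : Rd d} (S : PsiSetting d)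
    (h : TestAt x φ) : Integrable (fun z => secondDiff φ x z * S.j ‖z‖) := by
  have h1 := h.integrable_psiOp S
  refine (h1.add h1.comp_neg).congr (ae_of_all _ fun z => ?_)
  simp only [Pi.add_apply, norm_neg, secondDiff, sub_eq_add_neg, inner_neg_left]
  split_ifs <;> ring

lemma TestAt.two_mul_psiOp {φ : Rd d → ℝ} {x : Rd d} (S : PsiSetting d) (h : TestAt x φ) :
    2 * psiOp S φ x = ∫ z, secondDiff φ x z * S.j ‖z‖ := by
  have h1 := h.integrable_psiOp S
  have h2 := integral_neg_eq_self (fun z => (φ x - φ (x + z) +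
    (if ‖z‖ ≤ 1 then ⟪z, gradient φ x⟫ else 0)) * S.j ‖z‖) volume
  rw [two_mul]
  nth_rewrite 2 [psiOp]
  rw [← h2, psiOp, ← integral_add h1 h1.comp_neg]
  refine integral_congr_ae (ae_of_all _ fun z => ?_)
  simp only [norm_neg, secondDiff, sub_eq_add_neg, inner_neg_left]
  split_ifs <;> ring

/-- A bounded smooth function with a strict global minimum at `x`. -/
def bump (x y : Rd d) : ℝ := ‖y - x‖ ^ 2 / (1 + ‖y - x‖ ^ 2)

lemma contDiff_bump (x : Rd d) : ContDiff ℝ 2 (bump x) := by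
  have h : ContDiff ℝ 2 fun y : Rd d => ‖y - x‖ ^ 2 := (contDiff_id.sub contDiff_const).norm_sq ℝ
  exact h.div (contDiff_const.add h) fun y => by positivity

lemma bump_self (x : Rd d) : bump x x = 0 := by simp [bump]

lemma bump_pos {x y : Rd d} (h : y ≠ x) : 0 < bump x y := by
  have : 0 < ‖y - x‖ := norm_pos_iff.2 (sub_ne_zero.2 h)
  unfold bump
  positivity

lemma abs_bump_le (x y : Rd d) : |bump x y| ≤ 1 := by
  have : 0 ≤ bump x y := by unfold bump; positivity
  rw [abs_of_nonneg this, bump, div_le_one (by positivity)]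
  linarith

lemma testAt_bump (x : Rd d) : TestAt x (bump x) :=
  ⟨⟨1, abs_bump_le x⟩, (contDiff_bump x).continuous, univ, univ_mem,
    (contDiff_bump x).contDiffOn⟩

lemma TestAt.add_mul_bump {φ : Rd d → ℝ} {x : Rd d} (h : TestAt x φ) (ε : ℝ) :
    TestAt x (fun y => φ y + ε * bump x y) := by
  obtain ⟨⟨M, hM⟩, hc, U, hU, hφ⟩ := h
  refine ⟨⟨M + |ε| * 1, fun y => ?_⟩, hc.add ((contDiff_bump x).continuous.const_mul ε), U, hU,
    hφ.add (contDiff_const.mul (contDiff_bump x)).contDiffOn⟩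
  refine (abs_add_le _ _).trans ?_
  rw [abs_mul]
  gcongr
  · exact hM y
  · exact abs_bump_le x y

lemma TestAt.two_mul_psiOp_add_mul_bump {φ : Rd d → ℝ} {x : Rd d} (S : PsiSetting d)
    (h : TestAt x φ) (ε : ℝ) :
    2 * psiOp S (fun y => φ y + ε * bump x y) x =
      (∫ z, secondDiff φ x z * S.j ‖z‖) + ε * ∫ z, secondDiff (bump x) x z * S.j ‖z‖ := by
  rw [(h.add_mul_bump ε).two_mul_psiOp S, ← integral_const_mul,
    ← integral_add (h.integrable_secondDiff S)
      (((testAt_bump x).integrable_secondDiff S).const_mul ε)]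
  refine integral_congr_ae (ae_of_all _ fun z => ?_)
  simp only [secondDiff]
  ring

lemma le_of_forall_pos_le_add_mul {a b c : ℝ} (h : ∀ ε > 0, a ≤ b + ε * c) : a ≤ b := by
  have h1 : Tendsto (fun ε : ℝ => b + ε * c) (𝓝[>] 0) (𝓝 (b + 0 * c)) :=
    (Continuous.tendsto (by fun_prop) _).mono_left nhdsWithin_le_nhds
  rw [zero_mul, add_zero] at h1
  exact ge_of_tendsto h1 (eventually_mem_nhdsWithin.mono h)

lemma IsSuperSol.le_integral {S : PsiSetting d} {Ω : Set (Rd d)} {g u : Rd d → ℝ}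
    (h : IsSuperSol S Ω (fun _ => 0) g u) {x : Rd d} (hx : x ∈ Ω) {φ : Rd d → ℝ}
    (hφ : TestAt x φ) (hφx : φ x = u x) (hle : ∀ y, φ y ≤ u y) :
    2 * g x ≤ ∫ z, secondDiff φ x z * S.j ‖z‖ := by
  refine le_of_forall_pos_le_add_mul (c := -∫ z, secondDiff (bump x) x z * S.j ‖z‖)
    fun ε hε => ?_
  have h1 := h.2 x hx _ (hφ.add_mul_bump (-ε)) (by simp [bump_self, hφx]) (fun y hy => by
    have := mul_pos hε (bump_pos hy)
    linarith [hle y])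
  have h2 := hφ.two_mul_psiOp_add_mul_bump S (-ε)
  linarith

lemma IsSubSol.integral_le {S : PsiSetting d} {Ω : Set (Rd d)} {g u : Rd d → ℝ}
    (h : IsSubSol S Ω (fun _ => 0) g u) {x : Rd d} (hx : x ∈ Ω) {φ : Rd d → ℝ}
    (hφ : TestAt x φ) (hφx : φ x = u x) (hle : ∀ y, u y ≤ φ y) :
    ∫ z, secondDiff φ x z * S.j ‖z‖ ≤ 2 * g x := by
  refine le_of_forall_pos_le_add_mul (c := -∫ z, secondDiff (bump x) x z * S.j ‖z‖)
    fun ε hε => ?_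
  have h1 := h.2 x hx _ (hφ.add_mul_bump ε) (by simp [bump_self, hφx]) (fun y hy => by
    have := mul_pos hε (bump_pos hy)
    linarith [hle y])
  have h2 := hφ.two_mul_psiOp_add_mul_bump S ε
  linarith

end Taylor

/-! ### Gluing test functions and doubling of variables -/

section Glue

variable {d : ℕ}

/-- A continuous cutoff, equal to `1` on `closedBall 0 δ` and to `0` outside `ball 0 (2 * δ)`. -/
def cutoff (δ : ℝ) (z : Rd d) : ℝ := max 0 (min 1 (2 - ‖z‖ / δ))

/-- The function equal to `P` near `x` and to `u` away from `x`. -/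
def glue (P u : Rd d → ℝ) (x : Rd d) (δ : ℝ) (y : Rd d) : ℝ :=
  cutoff δ (y - x) * P y + (1 - cutoff δ (y - x)) * u y

lemma cutoff_nonneg (δ : ℝ) (z : Rd d) : 0 ≤ cutoff δ z := le_max_left _ _

lemma cutoff_le_one (δ : ℝ) (z : Rd d) : cutoff δ z ≤ 1 :=
  max_le zero_le_one (min_le_left _ _)

lemma cutoff_neg (δ : ℝ) (z : Rd d) : cutoff δ (-z) = cutoff δ z := by simp [cutoff]

lemma cutoff_eq_one {δ : ℝ} (hδ : 0 < δ) {z : Rd d} (hz : ‖z‖ ≤ δ) : cutoff δ z = 1 := by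
  have : ‖z‖ / δ ≤ 1 := by rwa [div_le_one hδ]
  rw [cutoff, min_eq_left (by linarith), max_eq_right zero_le_one]

lemma cutoff_eq_zero {δ : ℝ} (hδ : 0 < δ) {z : Rd d} (hz : 2 * δ ≤ ‖z‖) : cutoff δ z = 0 := by
  have : 2 ≤ ‖z‖ / δ := by rwa [le_div_iff₀ hδ]
  exact max_eq_left ((min_le_right _ _).trans (by linarith))

lemma continuous_cutoff (δ : ℝ) : Continuous (cutoff δ : Rd d → ℝ) := by
  unfold cutoff
  fun_prop

variable {P u : Rd d → ℝ} {x : Rd d} {δ : ℝ}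

lemma secondDiff_glue (hδ : 0 < δ) (hx : P x = u x) (z : Rd d) :
    secondDiff (glue P u x δ) x z =
      cutoff δ z * secondDiff P x z + (1 - cutoff δ z) * secondDiff u x z := by
  have h1 : x - z - x = -z := by abel
  have h2 : cutoff δ (0 : Rd d) = 1 := cutoff_eq_one hδ (by simpa using hδ.le)
  simp only [secondDiff, glue, sub_self, add_sub_cancel_left, h1, cutoff_neg, h2, hx]
  ring

lemma glue_self (hx : P x = u x) : glue P u x δ x = u x := by
  simp only [glue, hx]
  ring

lemma glue_le (hδ : 0 < δ) (h : ∀ y ∈ ball x (2 * δ), P y ≤ u y) (y : Rd d) :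
    glue P u x δ y ≤ u y := by
  unfold glue
  rcases lt_or_ge ‖y - x‖ (2 * δ) with hy | hy
  · have := h y (by rwa [mem_ball_iff_norm])
    nlinarith [cutoff_nonneg δ (y - x)]
  · simp [cutoff_eq_zero hδ hy]

lemma le_glue (hδ : 0 < δ) (h : ∀ y ∈ ball x (2 * δ), u y ≤ P y) (y : Rd d) :
    u y ≤ glue P u x δ y := by
  unfold glue
  rcases lt_or_ge ‖y - x‖ (2 * δ) with hy | hy
  · have := h y (by rwa [mem_ball_iff_norm])
    nlinarith [cutoff_nonneg δ (y - x)]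
  · simp [cutoff_eq_zero hδ hy]

lemma testAt_glue (hδ : 0 < δ) (hP : ContDiff ℝ 2 P) (hu : Continuous u) {M : ℝ}
    (hM : ∀ y, |u y| ≤ M) : TestAt x (glue P u x δ) := by
  refine ⟨?_, ?_, ball x δ, ball_mem_nhds _ hδ, ?_⟩
  · obtain ⟨B, hB⟩ := (isCompact_closedBall x (2 * δ)).exists_bound_of_continuousOn
      hP.continuous.continuousOn
    have hB0 : 0 ≤ B := (norm_nonneg _).trans (hB x (mem_closedBall_self (by positivity)))
    refine ⟨B + M, fun y => (abs_add_le _ _).trans (add_le_add ?_ ?_)⟩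
    · rw [abs_mul, abs_of_nonneg (cutoff_nonneg _ _)]
      rcases le_total ‖y - x‖ (2 * δ) with hy | hy
      · have := hB y (by rwa [mem_closedBall_iff_norm])
        exact (mul_le_of_le_one_left (abs_nonneg _) (cutoff_le_one _ _)).trans this
      · simpa [cutoff_eq_zero hδ hy] using hB0
    · have h1 := cutoff_le_one δ (y - x)
      have h0 := cutoff_nonneg δ (y - x)
      rw [abs_mul, abs_of_nonneg (by linarith)]
      exact (mul_le_of_le_one_left (abs_nonneg _) (by linarith)).trans (hM y)
  · have h1 : Continuous fun y => cutoff δ (y - x) := (continuous_cutoff δ).comp (by fun_prop)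
    exact (h1.mul hP.continuous).add ((continuous_const.sub h1).mul hu)
  · refine hP.contDiffOn.congr fun y hy => ?_
    rw [mem_ball_iff_norm] at hy
    simp [glue, cutoff_eq_one hδ hy.le]

lemma measurable_secondDiff {φ : Rd d → ℝ} (hφ : Continuous φ) (x : Rd d) :
    Measurable (secondDiff φ x) := by
  unfold secondDiff
  exact Continuous.measurable (by fun_prop)

lemma abs_secondDiff_le {φ : Rd d → ℝ} {M : ℝ} (hM : ∀ y, |φ y| ≤ M) (x z : Rd d) :
    |secondDiff φ x z| ≤ 4 * M := by
  have h1 := abs_le.1 (hM x)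
  have h2 := abs_le.1 (hM (x + z))
  have h3 := abs_le.1 (hM (x - z))
  rw [secondDiff, abs_le]
  constructor <;> linarith

lemma integrable_secondDiff_glue {k : Rd d → ℝ} (hk : IsLevyDensity k) (hδ : 0 < δ)
    (hP : ContDiff ℝ 2 P) (hu : Continuous u) {M : ℝ} (hM : ∀ y, |u y| ≤ M) (hx : P x = u x)
    {c : ℝ} (hc : ∀ z, secondDiff P x z = c * ‖z‖ ^ 2) :
    Integrable (fun z => secondDiff (glue P u x δ) x z * k z) := by
  obtain ⟨⟨B, hB⟩, hcont, -⟩ := testAt_glue (x := x) hδ hP hu hM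
  refine hk.integrable_mul_of_le (measurable_secondDiff hcont x) hδ
    (fun z => abs_secondDiff_le hB x z) (C := |c|) fun z hz => ?_
  rw [secondDiff_glue hδ hx, cutoff_eq_one hδ hz.le, hc, one_mul, sub_self, zero_mul, add_zero,
    abs_mul, abs_of_nonneg (sq_nonneg ‖z‖)]

end Glue

section Doubling

variable {d : ℕ}

lemma norm_add_sub_sq_add (x y z : Rd d) :
    ‖x + z - y‖ ^ 2 + ‖x - z - y‖ ^ 2 = 2 * ‖x - y‖ ^ 2 + 2 * ‖z‖ ^ 2 := by
  have h1 : x + z - y = (x - y) + z := by abel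
  have h2 : x - z - y = (x - y) - z := by abel
  rw [h1, h2]
  have := parallelogram_law_with_norm ℝ (x - y) z
  nlinarith

/-- `F ≤ I u` in the viscosity sense on `K`, for the symmetric operator with density `k`. -/
def ViscSuper (k : Rd d → ℝ) (K : Set (Rd d)) (F u : Rd d → ℝ) : Prop :=
  ∀ x ∈ K, ∀ φ, TestAt x φ → φ x = u x → (∀ y, φ y ≤ u y) →
    F x ≤ ∫ z, secondDiff φ x z * k z

/-- `I w ≤ F` in the viscosity sense on `K`, for the symmetric operator with density `k`. -/
def ViscSub (k : Rd d → ℝ) (K : Set (Rd d)) (F w : Rd d → ℝ) : Prop :=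
  ∀ x ∈ K, ∀ φ, TestAt x φ → φ x = w x → (∀ y, w y ≤ φ y) →
    ∫ z, secondDiff φ x z * k z ≤ F x

lemma tendsto_measure_ball_zero (hd : 2 ≤ d) (x : Rd d) :
    Tendsto (fun δ => volume (ball x δ)) (𝓝[>] 0) (𝓝 0) := by
  have : Nonempty (Fin d) := ⟨⟨0, by omega⟩⟩
  have h := tendsto_measure_thickening_of_isClosed (μ := (volume : Measure (Rd d))) (s := {x})
    ⟨1, one_pos, by rw [thickening_singleton]; exact measure_ball_lt_top.ne⟩ isClosed_singleton
  simpa [thickening_singleton] using h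

/-- The penalised function used for doubling the variables. -/
def penal (u w : Rd d → ℝ) (x₀ : Rd d) (a η : ℝ) (p : Rd d × Rd d) : ℝ :=
  u p.1 - w p.2 + a * ‖p.1 - p.2‖ ^ 2 + η * ‖p.1 - x₀‖ ^ 2

variable {k : Rd d → ℝ} {u w F H : Rd d → ℝ} {M : ℝ} {x₀ : Rd d} {r : ℝ}

lemma sub_le_at_penal_min (hd : 2 ≤ d) (hk : IsLevyDensity k) (hu : Continuous u)
    (hw : Continuous w) (huM : ∀ y, |u y| ≤ M) (hwM : ∀ y, |w y| ≤ M)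
    (hF : ViscSuper k (closedBall x₀ r) F u) (hH : ViscSub k (closedBall x₀ r) H w)
    {ρ : ℝ} (hρ : 0 < ρ) (hρr : 2 * ρ ≤ r) (hρ1 : ρ ≤ 1) {a η : ℝ} (ha : 0 ≤ a) (hη : 0 ≤ η)
    {x y : Rd d} (hx : x ∈ ball x₀ (r / 2)) (hy : y ∈ ball x₀ (r / 2))
    (hmin : ∀ p ∈ closedBall x₀ r ×ˢ closedBall x₀ r,
      penal u w x₀ a η (x, y) ≤ penal u w x₀ a η p) :
    F x - H y ≤ η * (2 * ∫ z in ball (0 : Rd d) ρ, min 1 (‖z‖ ^ 2) * k z) +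
      ∫ z in (ball (0 : Rd d) ρ)ᶜ, (secondDiff u x z - secondDiff w y z) * k z := by
  have hmem : ∀ p ∈ ball x₀ (r / 2), ∀ q, ‖q - p‖ < r / 2 → q ∈ closedBall x₀ r := by
    intro p hp q hq
    rw [mem_closedBall_iff_norm]
    rw [mem_ball_iff_norm] at hp
    have : q - x₀ = (q - p) + (p - x₀) := by abel
    rw [this]
    linarith [norm_add_le (q - p) (p - x₀)]
  have hr2 : 0 < r / 2 := by linarith
  have hxK : x ∈ closedBall x₀ r := hmem x hx x (by simpa using hr2)
  have hyK : y ∈ closedBall x₀ r := hmem y hy y (by simpa using hr2)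
  set P : Rd d → ℝ := fun q =>
    u x + a * ‖x - y‖ ^ 2 + η * ‖x - x₀‖ ^ 2 - a * ‖q - y‖ ^ 2 - η * ‖q - x₀‖ ^ 2 with hPdef
  set Q : Rd d → ℝ := fun q => w y - a * ‖x - y‖ ^ 2 + a * ‖q - x‖ ^ 2 with hQdef
  have hnsq : ∀ p : Rd d, ContDiff ℝ 2 fun q : Rd d => ‖q - p‖ ^ 2 := fun p =>
    (contDiff_id.sub contDiff_const).norm_sq ℝ
  have hPc : ContDiff ℝ 2 P := by
    have h1 := hnsq y
    have h2 := hnsq x₀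
    exact (contDiff_const.sub (contDiff_const.mul h1)).sub (contDiff_const.mul h2)
  have hQc : ContDiff ℝ 2 Q := contDiff_const.add (contDiff_const.mul (hnsq x))
  have hPx : P x = u x := by simp only [hPdef]; ring
  have hQy : Q y = w y := by simp only [hQdef, norm_sub_rev y x]; ring
  have hPsd : ∀ z, secondDiff P x z = (2 * (a + η)) * ‖z‖ ^ 2 := by
    intro z
    have h1 := norm_add_sub_sq_add x y z
    have h2 := norm_add_sub_sq_add x x₀ z
    simp only [secondDiff, hPdef]
    linear_combination a * h1 + η * h2
  have hQsd : ∀ z, secondDiff Q y z = (-(2 * a)) * ‖z‖ ^ 2 := by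
    intro z
    have h1 := norm_add_sub_sq_add y x z
    simp only [secondDiff, hQdef]
    linear_combination -a * h1
  have hPu : ∀ q ∈ closedBall x₀ r, P q ≤ u q := by
    intro q hq
    have := hmin (q, y) ⟨hq, hyK⟩
    simp only [penal] at this
    simp only [hPdef]
    linarith
  have hQw : ∀ q ∈ closedBall x₀ r, w q ≤ Q q := by
    intro q hq
    have := hmin (x, q) ⟨hxK, hq⟩
    simp only [penal] at this
    simp only [hQdef, norm_sub_rev q x]
    linarith
  have hsd : ∀ z, ‖z‖ < r / 2 → secondDiff u x z - secondDiff w y z ≤ 2 * η * ‖z‖ ^ 2 := by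
    intro z hz
    have h1 := hmin (x + z, y + z)
      ⟨hmem x hx _ (by simpa using hz), hmem y hy _ (by simpa using hz)⟩
    have h2 := hmin (x - z, y - z)
      ⟨hmem x hx _ (by simpa using hz), hmem y hy _ (by simpa using hz)⟩
    simp only [penal, add_sub_add_right_eq_sub, sub_sub_sub_cancel_right] at h1 h2
    have h3 := norm_add_sub_sq_add x x₀ z
    simp only [secondDiff]
    nlinarith
  set q : Rd d → ℝ := fun z => min 1 (‖z‖ ^ 2) * k z with hq
  have hqi : Integrable q := hk.integrable
  set T := ∫ z in (ball (0 : Rd d) ρ)ᶜ, (secondDiff u x z - secondDiff w y z) * k z with hT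
  have hTi : IntegrableOn (fun z => (secondDiff u x z - secondDiff w y z) * k z)
      (ball (0 : Rd d) ρ)ᶜ := by
    refine hk.integrableOn_mul hρ (M := 8 * M)
      ((measurable_secondDiff hu x).sub (measurable_secondDiff hw y)) fun z => ?_
    refine (abs_sub _ _).trans ?_
    linarith [abs_secondDiff_le huM x z, abs_secondDiff_le hwM y z]
  have key : ∀ δ > 0, 2 * δ ≤ ρ → F x - H y ≤ (4 * a + 2 * η) * (∫ z in ball 0 (2 * δ), q z) +
      2 * η * (∫ z in ball 0 ρ, q z) + T := by
    intro δ hδ hδρ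
    have hball : ∀ p ∈ ball x₀ (r / 2), ∀ q ∈ ball p (2 * δ), q ∈ closedBall x₀ r := by
      intro p hp q hq
      rw [mem_ball_iff_norm] at hq
      exact hmem p hp q (by linarith)
    have h1 := hF x hxK (glue P u x δ) (testAt_glue hδ hPc hu huM) (glue_self hPx)
      (glue_le hδ fun q hq => hPu q (hball x hx q hq))
    have h2 := hH y hyK (glue Q w y δ) (testAt_glue hδ hQc hw hwM) (glue_self hQy)
      (le_glue hδ fun q hq => hQw q (hball y hy q hq))
    have i1 := integrable_secondDiff_glue hk hδ hPc hu huM hPx hPsd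
    have i2 := integrable_secondDiff_glue hk hδ hQc hw hwM hQy hQsd
    have j1 : Integrable ((ball (0 : Rd d) (2 * δ)).indicator q) :=
      hqi.indicator measurableSet_ball
    have j2 : Integrable ((ball (0 : Rd d) ρ).indicator q) := hqi.indicator measurableSet_ball
    have j12 : Integrable (fun z => (4 * a + 2 * η) * (ball (0 : Rd d) (2 * δ)).indicator q z +
        2 * η * (ball (0 : Rd d) ρ).indicator q z) := (j1.const_mul _).add (j2.const_mul _)
    have j3 := (integrable_indicator_iff measurableSet_ball.compl).2 hTi
    calc F x - H y
        ≤ (∫ z, secondDiff (glue P u x δ) x z * k z) -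
          ∫ z, secondDiff (glue Q w y δ) y z * k z := by linarith
      _ = ∫ z, (secondDiff (glue P u x δ) x z * k z - secondDiff (glue Q w y δ) y z * k z) :=
          (integral_sub i1 i2).symm
      _ ≤ ∫ z, ((4 * a + 2 * η) * (ball (0 : Rd d) (2 * δ)).indicator q z +
          2 * η * (ball (0 : Rd d) ρ).indicator q z + ((ball (0 : Rd d) ρ)ᶜ).indicator
          (fun z => (secondDiff u x z - secondDiff w y z) * k z) z) := by
          refine integral_mono (i1.sub i2) (j12.add j3) ?_
          intro z
          simp only
          rw [secondDiff_glue hδ hPx, secondDiff_glue hδ hQy, hPsd, hQsd]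
          have hkz := hk.nonneg z
          have hc0 := cutoff_nonneg δ z
          have hc1 := cutoff_le_one δ z
          rcases lt_or_ge ‖z‖ ρ with hz | hz
          · have hz1 : min 1 (‖z‖ ^ 2) = ‖z‖ ^ 2 :=
              min_eq_right (pow_le_one₀ (norm_nonneg _) (hz.le.trans hρ1))
            have hm : z ∈ ball (0 : Rd d) ρ := by simpa using hz
            have hs := hsd z (by linarith)
            rw [indicator_of_mem hm,
              indicator_of_notMem (s := (ball (0 : Rd d) ρ)ᶜ) (by simpa using hz),
              add_zero]
            have hterm : (4 * a + 2 * η) * cutoff δ z * (‖z‖ ^ 2 * k z) ≤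
                (4 * a + 2 * η) * (ball (0 : Rd d) (2 * δ)).indicator q z := by
              rw [mul_assoc]
              refine mul_le_mul_of_nonneg_left ?_ (by positivity)
              rcases lt_or_ge ‖z‖ (2 * δ) with hz2 | hz2
              · rw [indicator_of_mem (by simpa using hz2)]
                simp only [hq, hz1]
                exact mul_le_of_le_one_left (by positivity) hc1
              · rw [cutoff_eq_zero hδ hz2, indicator_of_notMem (by simpa using hz2), zero_mul]
            have hterm2 : (1 - cutoff δ z) * ((secondDiff u x z - secondDiff w y z) * k z) ≤
                2 * η * q z := by
              simp only [hq, hz1]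
              have h5 : (secondDiff u x z - secondDiff w y z) * k z ≤ 2 * η * ‖z‖ ^ 2 * k z :=
                mul_le_mul_of_nonneg_right hs hkz
              have h6 : 0 ≤ 2 * η * ‖z‖ ^ 2 * k z := by positivity
              nlinarith
            calc _ = (4 * a + 2 * η) * cutoff δ z * (‖z‖ ^ 2 * k z) +
                  (1 - cutoff δ z) * ((secondDiff u x z - secondDiff w y z) * k z) := by ring
              _ ≤ _ := add_le_add hterm hterm2
          · rw [cutoff_eq_zero hδ (hδρ.trans hz),
              indicator_of_notMem (s := ball (0 : Rd d) ρ) (by simpa using hz),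
              indicator_of_notMem (s := ball (0 : Rd d) (2 * δ)) (by simpa using hδρ.trans hz),
              indicator_of_mem (s := (ball (0 : Rd d) ρ)ᶜ) (by simpa using hz)]
            apply le_of_eq
            ring
      _ = _ := by
          rw [integral_add j12 j3,
            integral_add (j1.const_mul _) (j2.const_mul _), integral_const_mul,
            integral_const_mul, integral_indicator measurableSet_ball,
            integral_indicator measurableSet_ball, integral_indicator measurableSet_ball.compl]
  have hlim : Tendsto (fun δ : ℝ => (4 * a + 2 * η) * (∫ z in ball 0 (2 * δ), q z) +
      2 * η * (∫ z in ball 0 ρ, q z) + T) (𝓝[>] 0)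
      (𝓝 ((4 * a + 2 * η) * 0 + 2 * η * (∫ z in ball 0 ρ, q z) + T)) := by
    refine Tendsto.add_const _ (Tendsto.add_const _ (Tendsto.const_mul _ ?_))
    refine hqi.tendsto_setIntegral_nhds_zero ((tendsto_measure_ball_zero hd 0).comp ?_)
    refine tendsto_nhdsWithin_iff.2 ⟨?_, ?_⟩
    · have : Tendsto (fun δ : ℝ => 2 * δ) (𝓝 0) (𝓝 (2 * 0)) := by
        exact Continuous.tendsto (by fun_prop) _
      rw [mul_zero] at this
      exact this.mono_left nhdsWithin_le_nhds
    · filter_upwards [eventually_mem_nhdsWithin] with δ hδ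
      have : (0 : ℝ) < δ := hδ
      simpa using this
  have := ge_of_tendsto hlim (by
    filter_upwards [Ioo_mem_nhdsGT (show (0 : ℝ) < ρ / 2 by positivity)] with δ hδ
    exact key δ hδ.1 (by linarith [hδ.2]))
  linarith

lemma sub_le_integral_of_isMin (hd : 2 ≤ d) (hk : IsLevyDensity k) (hu : Continuous u)
    (hw : Continuous w) (huM : ∀ y, |u y| ≤ M) (hwM : ∀ y, |w y| ≤ M)
    {C β : ℝ} (hβ : 0 < β) (hHol : ∀ x y, |w x - w y| ≤ C * ‖x - y‖ ^ β)
    (hFc : Continuous F) (hHc : Continuous H)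
    (hF : ViscSuper k (closedBall x₀ r) F u) (hH : ViscSub k (closedBall x₀ r) H w)
    (hmin : ∀ x ∈ closedBall x₀ r, u x₀ - w x₀ ≤ u x - w x)
    {ρ : ℝ} (hρ : 0 < ρ) (hρr : 2 * ρ ≤ r) (hρ1 : ρ ≤ 1) :
    F x₀ - H x₀ ≤
      ∫ z in (ball (0 : Rd d) ρ)ᶜ, (secondDiff u x₀ z - secondDiff w x₀ z) * k z := by
  have hr : 0 < r := by linarith
  refine le_of_forall_pos_le_add_mul
    (c := 2 * ∫ z in ball (0 : Rd d) ρ, min 1 (‖z‖ ^ 2) * k z) fun η hη => ?_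
  have hex : ∀ n : ℕ, ∃ p ∈ closedBall x₀ r ×ˢ closedBall x₀ r,
      IsMinOn (penal u w x₀ (n + 1) η) (closedBall x₀ r ×ˢ closedBall x₀ r) p := by
    intro n
    refine ((isCompact_closedBall x₀ r).prod (isCompact_closedBall x₀ r)).exists_isMinOn
      ⟨(x₀, x₀), ⟨mem_closedBall_self hr.le, mem_closedBall_self hr.le⟩⟩ ?_
    refine Continuous.continuousOn ?_
    unfold penal
    fun_prop
  choose p hpK hpmin using hex
  have h0 : ∀ n : ℕ, penal u w x₀ (n + 1) η (p n) ≤ u x₀ - w x₀ := by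
    intro n
    have := hpmin n (show (x₀, x₀) ∈ closedBall x₀ r ×ˢ closedBall x₀ r from
      ⟨mem_closedBall_self hr.le, mem_closedBall_self hr.le⟩)
    simpa [penal] using this
  have hdist : Tendsto (fun n => ‖(p n).1 - (p n).2‖) atTop (𝓝 0) := by
    have h1 : Tendsto (fun n : ℕ => Real.sqrt (4 * M * (1 / ((n : ℝ) + 1)))) atTop
        (𝓝 (Real.sqrt (4 * M * 0))) :=
      (Real.continuous_sqrt.tendsto _).comp
        (tendsto_one_div_add_atTop_nhds_zero_nat.const_mul (4 * M))
    rw [mul_zero, Real.sqrt_zero] at h1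
    refine squeeze_zero (fun _ => norm_nonneg _) (fun n => ?_) h1
    refine Real.le_sqrt_of_sq_le ?_
    rw [mul_one_div, le_div_iff₀ (by positivity)]
    have h2 := h0 n
    simp only [penal] at h2
    have h3 := abs_le.1 (huM x₀)
    have h4 := abs_le.1 (hwM x₀)
    have h5 := abs_le.1 (huM (p n).1)
    have h6 := abs_le.1 (hwM (p n).2)
    have h7 : 0 ≤ η * ‖(p n).1 - x₀‖ ^ 2 := by positivity
    linarith
  have hx : Tendsto (fun n => (p n).1) atTop (𝓝 x₀) := by
    rw [tendsto_iff_norm_sub_tendsto_zero]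
    have h1 : Tendsto (fun n => Real.sqrt (C * ‖(p n).1 - (p n).2‖ ^ β / η)) atTop
        (𝓝 (Real.sqrt (C * (0 : ℝ) ^ β / η))) :=
      (Real.continuous_sqrt.tendsto _).comp
        (((hdist.rpow_const (Or.inr hβ.le)).const_mul C).div_const η)
    rw [Real.zero_rpow hβ.ne', mul_zero, zero_div, Real.sqrt_zero] at h1
    refine squeeze_zero (fun _ => norm_nonneg _) (fun n => ?_) h1
    refine Real.le_sqrt_of_sq_le ?_
    rw [le_div_iff₀ hη]
    have h2 := h0 n
    simp only [penal] at h2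
    have h3 := hmin (p n).1 (hpK n).1
    have h4 := (abs_le.1 (hHol (p n).1 (p n).2)).1
    have h5 : 0 ≤ ((n : ℝ) + 1) * ‖(p n).1 - (p n).2‖ ^ 2 := by positivity
    linarith
  have hy : Tendsto (fun n => (p n).2) atTop (𝓝 x₀) := by
    have h1 : Tendsto (fun n => (p n).1 - (p n).2) atTop (𝓝 0) :=
      tendsto_zero_iff_norm_tendsto_zero.2 hdist
    have h2 := hx.sub h1
    simpa using h2
  have hlim1 : Tendsto (fun n => F (p n).1 - H (p n).2) atTop (𝓝 (F x₀ - H x₀)) :=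
    ((hFc.tendsto _).comp hx).sub ((hHc.tendsto _).comp hy)
  have hlim2 : Tendsto (fun n => ∫ z in (ball (0 : Rd d) ρ)ᶜ,
      (secondDiff u (p n).1 z - secondDiff w (p n).2 z) * k z) atTop
      (𝓝 (∫ z in (ball (0 : Rd d) ρ)ᶜ, (secondDiff u x₀ z - secondDiff w x₀ z) * k z)) := by
    refine tendsto_integral_of_dominated_convergence (fun z => 8 * M * k z) ?_
      ((hk.integrableOn_compl_ball hρ).const_mul _) ?_ ?_
    · intro n
      exact (((measurable_secondDiff hu _).sub (measurable_secondDiff hw _)).mul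
        hk.meas).aestronglyMeasurable
    · intro n
      filter_upwards with z
      rw [norm_mul, Real.norm_of_nonneg (hk.nonneg z)]
      refine mul_le_mul_of_nonneg_right ((abs_sub _ _).trans ?_) (hk.nonneg z)
      linarith [abs_secondDiff_le huM (p n).1 z, abs_secondDiff_le hwM (p n).2 z]
    · filter_upwards with z
      have h1 : Continuous fun x => secondDiff u x z := by unfold secondDiff; fun_prop
      have h2 : Continuous fun x => secondDiff w x z := by unfold secondDiff; fun_prop
      exact (((h1.tendsto _).comp hx).sub ((h2.tendsto _).comp hy)).mul_const _
  refine le_of_tendsto_of_tendsto hlim1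
    (hlim2.add_const (η * (2 * ∫ z in ball (0 : Rd d) ρ, min 1 (‖z‖ ^ 2) * k z))) ?_
  have hb := ball_mem_nhds x₀ (show 0 < r / 2 by positivity)
  filter_upwards [hx hb, hy hb] with n hxn hyn
  have := sub_le_at_penal_min hd hk hu hw huM hwM hF hH hρ hρr hρ1
    (a := (n : ℝ) + 1) (by positivity) hη.le hxn hyn (fun q hq => hpmin n hq)
  linarith

end Doubling

/-! ### Reflections -/

section Reflection

variable {d : ℕ} {e : Rd d}

lemma inner_self_eq_one (he : ‖e‖ = 1) : ⟪e, e⟫ = 1 := by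
  rw [real_inner_self_eq_norm_sq, he, one_pow]

lemma inner_reflAt (he : ‖e‖ = 1) (μ : ℝ) (x : Rd d) : ⟪reflAt e μ x, e⟫ = 2 * μ - ⟪x, e⟫ := by
  rw [reflAt, inner_sub_left, real_inner_smul_left, inner_self_eq_one he]
  ring

lemma reflAt_reflAt (he : ‖e‖ = 1) (μ : ℝ) (x : Rd d) : reflAt e μ (reflAt e μ x) = x := by
  rw [reflAt, inner_reflAt he, reflAt, sub_sub, ← add_smul]
  ring_nf
  simp

lemma reflAt_of_inner_eq {μ : ℝ} {x : Rd d} (h : ⟪x, e⟫ = μ) : reflAt e μ x = x := by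
  simp [reflAt, h]

lemma norm_reflAt_sub_sq (he : ‖e‖ = 1) (μ : ℝ) (x y : Rd d) :
    ‖reflAt e μ y - x‖ ^ 2 = ‖y - x‖ ^ 2 + 4 * (μ - ⟪y, e⟫) * (μ - ⟪x, e⟫) := by
  have h : reflAt e μ y - x = (y - x) - (2 * ⟪y, e⟫ - 2 * μ) • e := by
    rw [reflAt]
    abel
  rw [h, norm_sub_sq_real, norm_smul, he, real_inner_smul_right, inner_sub_left, mul_one,
    Real.norm_eq_abs, sq_abs]
  ring

lemma norm_sub_lt_norm_reflAt_sub (he : ‖e‖ = 1) {μ : ℝ} {x y : Rd d} (hx : ⟪x, e⟫ < μ)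
    (hy : ⟪y, e⟫ < μ) : ‖y - x‖ < ‖reflAt e μ y - x‖ := by
  refine lt_of_pow_lt_pow_left₀ 2 (norm_nonneg _) ?_
  rw [norm_reflAt_sub_sq he]
  have := mul_pos (sub_pos.2 hy) (sub_pos.2 hx)
  nlinarith

/-- The reflection across the hyperplane orthogonal to `e` through the origin. -/
def reflLin (he : ‖e‖ = 1) : Rd d ≃ₗᵢ[ℝ] Rd d where
  toFun := reflAt e 0
  invFun := reflAt e 0
  left_inv := reflAt_reflAt he 0
  right_inv := reflAt_reflAt he 0
  map_add' x y := by
    simp only [reflAt, inner_add_left, mul_zero, sub_zero, mul_add, add_smul]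
    abel
  map_smul' c x := by
    simp only [reflAt, real_inner_smul_left, mul_zero, sub_zero, RingHom.id_apply, smul_sub,
      smul_smul]
    ring_nf
  norm_map' x := by
    have h := norm_reflAt_sub_sq he 0 0 x
    simp only [sub_zero, inner_zero_left, mul_zero, add_zero] at h
    exact (pow_left_inj₀ (norm_nonneg _) (norm_nonneg _) two_ne_zero).1 h

lemma reflAt_eq_reflLin_add (he : ‖e‖ = 1) (μ : ℝ) (x : Rd d) :
    reflAt e μ x = reflLin he x + (2 * μ) • e := by
  change _ = reflAt e 0 x + _
  simp only [reflAt, sub_smul, mul_zero, zero_smul]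
  abel

lemma reflAt_add (he : ‖e‖ = 1) (μ : ℝ) (x z : Rd d) :
    reflAt e μ (x + z) = reflAt e μ x + reflLin he z := by
  rw [reflAt_eq_reflLin_add he, reflAt_eq_reflLin_add he, map_add]
  abel

lemma norm_reflAt_sub_reflAt (he : ‖e‖ = 1) (μ : ℝ) (x y : Rd d) :
    ‖reflAt e μ x - reflAt e μ y‖ = ‖x - y‖ := by
  rw [reflAt_eq_reflLin_add he, reflAt_eq_reflLin_add he, add_sub_add_right_eq_sub, ← map_sub,
    LinearIsometryEquiv.norm_map]

lemma contDiff_reflAt (μ : ℝ) : ContDiff ℝ 2 (reflAt e μ) := by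
  exact contDiff_id.sub
    (((contDiff_const.mul (contDiff_id.inner ℝ contDiff_const)).sub contDiff_const).smul
      contDiff_const)

lemma continuous_reflAt (μ : ℝ) : Continuous (reflAt e μ) := (contDiff_reflAt μ).continuous

lemma measurePreserving_reflAt (he : ‖e‖ = 1) (μ : ℝ) :
    MeasurePreserving (reflAt e μ) volume volume := by
  have h := (measurePreserving_add_right volume ((2 * μ) • e)).comp
    (reflLin he).measurePreserving
  have hfun : reflAt e μ = (fun x => x + (2 * μ) • e) ∘ reflLin he :=
    funext (reflAt_eq_reflLin_add he μ)
  rw [hfun]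
  exact h

/-- The reflection `reflAt e μ` as a homeomorphism. -/
def reflHomeo (he : ‖e‖ = 1) (μ : ℝ) : Rd d ≃ₜ Rd d where
  toFun := reflAt e μ
  invFun := reflAt e μ
  left_inv := reflAt_reflAt he μ
  right_inv := reflAt_reflAt he μ
  continuous_toFun := continuous_reflAt μ
  continuous_invFun := continuous_reflAt μ

lemma TestAt.comp_reflAt (he : ‖e‖ = 1) (μ : ℝ) {φ : Rd d → ℝ} {x : Rd d} (h : TestAt x φ) :
    TestAt (reflAt e μ x) (φ ∘ reflAt e μ) := by
  obtain ⟨⟨M, hM⟩, hc, U, hU, hφ⟩ := h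
  refine ⟨⟨M, fun y => hM _⟩, hc.comp (continuous_reflAt μ), reflAt e μ ⁻¹' U, ?_, ?_⟩
  · refine (continuous_reflAt μ).continuousAt.preimage_mem_nhds ?_
    rwa [reflAt_reflAt he]
  · exact hφ.comp (contDiff_reflAt μ).contDiffOn (mapsTo_preimage _ _)

lemma secondDiff_comp_reflAt (he : ‖e‖ = 1) (μ : ℝ) (φ : Rd d → ℝ) (x z : Rd d) :
    secondDiff (φ ∘ reflAt e μ) (reflAt e μ x) z = secondDiff φ x (reflLin he z) := by
  simp only [secondDiff, Function.comp, sub_eq_add_neg, reflAt_add he, reflAt_reflAt he, map_neg]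

lemma IsSubSol.viscSub_comp_reflAt (he : ‖e‖ = 1) (μ : ℝ) {S : PsiSetting d} {Ω : Set (Rd d)}
    {g u : Rd d → ℝ} (h : IsSubSol S Ω (fun _ => 0) g u) {K : Set (Rd d)}
    (hK : ∀ x ∈ K, reflAt e μ x ∈ Ω) :
    ViscSub (fun z => S.j ‖z‖) K (fun x => 2 * g (reflAt e μ x)) (u ∘ reflAt e μ) := by
  intro x hx φ hφ hφx hle
  have h1 := h.integral_le (hK x hx) (hφ.comp_reflAt he μ)
    (by simpa [reflAt_reflAt he] using hφx) (fun y => by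
      have := hle (reflAt e μ y)
      simpa [reflAt_reflAt he] using this)
  refine le_trans (le_of_eq ?_) h1
  have h2 := (reflLin he).measurePreserving.integral_comp
    (reflLin he).toHomeomorph.measurableEmbedding (fun z => secondDiff φ x z * S.j ‖z‖)
  rw [← h2]
  refine integral_congr_ae (ae_of_all _ fun z => ?_)
  simp only [secondDiff_comp_reflAt he, LinearIsometryEquiv.norm_map]

end Reflection

/-! ### Antisymmetric functions at a nonpositive minimum -/

section Antisymmetric

variable {d : ℕ} {e : Rd d}

lemma setIntegral_secondDiff {k : Rd d → ℝ} (hk : IsLevyDensity k) {v : Rd d → ℝ}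
    (hv : Continuous v) {M : ℝ} (hM : ∀ y, |v y| ≤ M) (x : Rd d) {ρ : ℝ} (hρ : 0 < ρ) :
    ∫ z in (ball (0 : Rd d) ρ)ᶜ, secondDiff v x z * k z =
      2 * ∫ y, ((ball x ρ)ᶜ).indicator (fun y => (v x - v y) * k (y - x)) y := by
  set a : Rd d → ℝ := ((ball (0 : Rd d) ρ)ᶜ).indicator (fun z => (v x - v (x + z)) * k z) with ha
  have hai : Integrable a := by
    refine (integrable_indicator_iff measurableSet_ball.compl).2 ?_
    refine hk.integrableOn_mul hρ (M := 2 * M) (Continuous.measurable (by fun_prop)) fun z => ?_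
    refine (abs_sub _ _).trans ?_
    linarith [hM x, hM (x + z)]
  have h1 : ∫ y, ((ball x ρ)ᶜ).indicator (fun y => (v x - v y) * k (y - x)) y = ∫ z, a z := by
    rw [← integral_sub_right_eq_self a x]
    refine integral_congr_ae (ae_of_all _ fun y => ?_)
    simp only [ha, indicator, mem_compl_iff, mem_ball_iff_norm, sub_zero, add_sub_cancel]
  have h2 : ∫ z, a (-z) = ∫ z, a z := integral_neg_eq_self a volume
  rw [h1, two_mul]
  nth_rewrite 1 [← h2]
  rw [← integral_add hai.comp_neg hai, ← integral_indicator measurableSet_ball.compl]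
  refine integral_congr_ae (ae_of_all _ fun z => ?_)
  simp only [ha, indicator, mem_compl_iff, mem_ball_iff_norm, sub_zero, norm_neg, secondDiff,
    hk.even, ← sub_eq_add_neg]
  split_ifs <;> ring

lemma false_of_antisymm_min (hd : 2 ≤ d) (S : PsiSetting d) (he : ‖e‖ = 1) {μ M : ℝ}
    {v : Rd d → ℝ} (hv : Continuous v) (hM : ∀ y, |v y| ≤ M)
    (hanti : ∀ y, v (reflAt e μ y) = -v y) {x : Rd d} (hx : ⟪x, e⟫ < μ) (hvx : v x ≤ 0)
    (hmin : ∀ y, ⟪y, e⟫ < μ → v x ≤ v y) {p : Rd d} (hp : ⟪p, e⟫ < μ) (hvp : v x < v p)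
    {ρ₀ : ℝ} (hρ₀ : 0 < ρ₀)
    (hnonneg : ∀ ρ, 0 < ρ → ρ < ρ₀ →
      0 ≤ ∫ z in (ball (0 : Rd d) ρ)ᶜ, secondDiff v x z * S.j ‖z‖) : False := by
  have hM0 : 0 ≤ M := (abs_nonneg _).trans (hM 0)
  set D := ‖p - x‖ / 2 with hD
  have hDpos : 0 < D := by
    have : p ≠ x := by
      rintro rfl
      exact lt_irrefl _ hvp
    have := norm_pos_iff.2 (sub_ne_zero.2 this)
    positivity
  have hopen : IsOpen {y : Rd d | ⟪y, e⟫ < μ ∧ v x < v y ∧ D < ‖y - x‖} := by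
    have o1 : IsOpen {y : Rd d | ⟪y, e⟫ < μ} :=
      isOpen_lt (continuous_id.inner continuous_const) continuous_const
    have o2 : IsOpen {y : Rd d | v x < v y} := isOpen_lt continuous_const hv
    have o3 : IsOpen {y : Rd d | D < ‖y - x‖} :=
      isOpen_lt continuous_const (continuous_id.sub continuous_const).norm
    exact o1.inter (o2.inter o3)
  obtain ⟨r, hr, hB⟩ := Metric.isOpen_iff.1 hopen p ⟨hp, hvp, by rw [hD] at *; linarith⟩
  set g : Rd d → ℝ := fun y => (v y - v x) * (S.j ‖y - x‖ - S.j ‖reflAt e μ y - x‖) with hg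
  have hjm := S.measurable_j
  have hgm : Measurable g := by
    have h1 : Measurable fun y => S.j ‖y - x‖ := hjm.comp (measurable_id.sub_const x)
    have h2 : Measurable fun y => S.j ‖reflAt e μ y - x‖ :=
      hjm.comp ((continuous_reflAt μ).measurable.sub_const x)
    exact (hv.measurable.sub_const _).mul (h1.sub h2)
  have hgpos : ∀ y ∈ ball p r, 0 < g y := by
    intro y hy
    obtain ⟨hy1, hy2, hy3⟩ := hB hy
    exact mul_pos (sub_pos.2 hy2) (sub_pos.2
      (S.j_strictAnti hd (hDpos.trans hy3) (norm_sub_lt_norm_reflAt_sub he hx hy1)))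
  have hgi : IntegrableOn g (ball p r) := by
    refine Measure.integrableOn_of_bounded (M := 2 * M * S.j D) measure_ball_lt_top.ne
      hgm.aestronglyMeasurable ?_
    filter_upwards [ae_restrict_mem measurableSet_ball] with y hy
    obtain ⟨hy1, hy2, hy3⟩ := hB hy
    rw [Real.norm_of_nonneg (hgpos y hy).le]
    have h1 := abs_le.1 (hM x)
    have h2 := abs_le.1 (hM y)
    refine mul_le_mul (by linarith) ?_ ?_ (by linarith)
    · have := S.j_strictAnti hd hDpos hy3
      have := S.j_nonneg ‖reflAt e μ y - x‖
      linarith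
    · exact sub_nonneg.2 (S.j_strictAnti hd (hDpos.trans hy3)
        (norm_sub_lt_norm_reflAt_sub he hx hy1)).le
  have hcpos : 0 < ∫ y in ball p r, g y := by
    rw [setIntegral_pos_iff_support_of_nonneg_ae
      ((ae_restrict_mem measurableSet_ball).mono fun y hy => (hgpos y hy).le) hgi]
    have : Function.support g ∩ ball p r = ball p r :=
      inter_eq_right.2 fun y hy => (hgpos y hy).ne'
    rw [this]
    exact measure_ball_pos _ _ hr
  set c := μ - ⟪x, e⟫ with hc
  have hc0 : 0 < c := sub_pos.2 hx
  set J := M * S.j c with hJ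
  have hJ0 : 0 ≤ J := mul_nonneg hM0 (S.j_nonneg c)
  have key : ∀ ρ, 0 < ρ → ρ < min ρ₀ (min D c) →
      (∫ y in ball p r, g y) ≤ J * (volume (ball x ρ)).toReal := by
    intro ρ hρ hρ'
    simp only [lt_min_iff] at hρ'
    obtain ⟨hρ1, hρ2, hρ3⟩ := hρ'
    set h : Rd d → ℝ := ((ball x ρ)ᶜ).indicator (fun y => (v x - v y) * S.j ‖y - x‖) with hh
    have h0 : 0 ≤ ∫ y, h y := by
      have h1 := hnonneg ρ hρ hρ1
      rw [setIntegral_secondDiff S.isLevyDensity hv hM x hρ] at h1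
      linarith
    have hmp := measurePreserving_reflAt he μ
    have hemb : MeasurableEmbedding (reflAt e μ) := (reflHomeo he μ).measurableEmbedding
    set T : Rd d → ℝ := fun y => (ball x ρ).indicator (fun _ => J) y - (ball p r).indicator g y
      with hT
    have i1 : Integrable ((ball x ρ).indicator fun _ => J) :=
      (integrable_indicator_iff measurableSet_ball).2
        (integrableOn_const measure_ball_lt_top.ne)
    have i2 : Integrable ((ball p r).indicator g) :=
      (integrable_indicator_iff measurableSet_ball).2 hgi
    have hTi : Integrable T := i1.sub i2
    have hTint : ∫ y, T y = J * (volume (ball x ρ)).toReal - ∫ y in ball p r, g y := by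
      rw [hT, integral_sub i1 i2, integral_indicator measurableSet_ball,
        integral_indicator measurableSet_ball, setIntegral_const, smul_eq_mul, mul_comm]
      rfl
    have hTzero : ∀ y, μ ≤ ⟪y, e⟫ → T y = 0 := by
      intro y hy
      have h1 : y ∉ ball x ρ := by
        intro hmem
        rw [mem_ball_iff_norm] at hmem
        have h2 := real_inner_le_norm (y - x) e
        rw [he, inner_sub_left] at h2
        linarith
      have h2 : y ∉ ball p r := fun hmem => absurd (hB hmem).1 (not_lt.2 hy)
      simp [hT, h1, h2]
    have hhi : Integrable h := by
      refine (integrable_indicator_iff measurableSet_ball.compl).2 ?_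
      have h1 := (integrable_indicator_iff measurableSet_ball.compl).2
        (S.isLevyDensity.integrableOn_mul hρ (g := fun z => v x - v (x + z)) (M := 2 * M)
          (Continuous.measurable (by fun_prop)) fun z => by
            refine (abs_sub _ _).trans ?_
            linarith [hM x, hM (x + z)])
      refine (integrable_indicator_iff measurableSet_ball.compl).1
        ((h1.comp_sub_right x).congr (ae_of_all _ fun y => ?_))
      simp only [indicator, mem_compl_iff, mem_ball_iff_norm, sub_zero, add_sub_cancel]
    have hle : ∀ y, ⟪y, e⟫ < μ → h y + h (reflAt e μ y) ≤ T y := by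
      intro y hy
      have hlt := norm_sub_lt_norm_reflAt_sub he hx hy
      have hvy := hmin y hy
      have hj2 := S.j_nonneg ‖reflAt e μ y - x‖
      rcases lt_or_ge ‖y - x‖ ρ with hyρ | hyρ
      · have hy1 : y ∈ ball x ρ := by rwa [mem_ball_iff_norm]
        have hy2 : y ∉ ball p r := fun hmem => by linarith [(hB hmem).2.2]
        have hy3 : h y = 0 := indicator_of_notMem (by simpa using hy1) _
        have hy4 : h (reflAt e μ y) ≤ J := by
          refine indicator_apply_le' (fun _ => ?_) fun _ => hJ0
          rw [hanti]
          have h1 := abs_le.1 (hM y)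
          have h2 : S.j ‖reflAt e μ y - x‖ ≤ S.j c := by
            have h3 := real_inner_le_norm (reflAt e μ y - x) e
            rw [he, inner_sub_left, inner_reflAt he, mul_one] at h3
            exact (S.j_strictAnti hd hc0 (by linarith)).le
          refine (mul_le_mul_of_nonneg_right
            (show v x - -v y ≤ M by linarith) hj2).trans ?_
          exact mul_le_mul_of_nonneg_left h2 hM0
        simp only [hT, indicator_of_mem hy1, indicator_of_notMem hy2, hy3]
        linarith
      · have hy1 : y ∉ ball x ρ := by rw [mem_ball_iff_norm]; exact not_lt.2 hyρ
        have hy2 : reflAt e μ y ∉ ball x ρ := by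
          rw [mem_ball_iff_norm]
          exact not_lt.2 (hyρ.trans hlt.le)
        have hj := S.j_strictAnti hd (hρ.trans_le hyρ) hlt
        have h1 : h y + h (reflAt e μ y) ≤ -g y := by
          rw [hh, indicator_of_mem (by simpa using hy1), indicator_of_mem (by simpa using hy2),
            hanti]
          simp only [hg]
          nlinarith
        have h2 : 0 ≤ g y := mul_nonneg (sub_nonneg.2 hvy) (sub_nonneg.2 hj.le)
        have h3 : (ball p r).indicator g y ≤ g y := indicator_le_self' (fun _ _ => h2) y
        simp only [hT, indicator_of_notMem hy1]
        linarith
    have hle' : ∀ y, h y + h (reflAt e μ y) ≤ T y + T (reflAt e μ y) := by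
      intro y
      have hR := inner_reflAt he μ y
      rcases lt_trichotomy ⟪y, e⟫ μ with hy | hy | hy
      · rw [hTzero (reflAt e μ y) (by linarith), add_zero]
        exact hle y hy
      · have hRy := reflAt_of_inner_eq hy
        have hv0 : v y = 0 := by
          have := hanti y
          rw [hRy] at this
          linarith
        rw [hRy, hTzero y hy.ge]
        have : h y ≤ 0 := by
          refine indicator_apply_le' (fun _ => ?_) fun _ => le_rfl
          rw [hv0]
          exact mul_nonpos_of_nonpos_of_nonneg (by linarith) (S.j_nonneg _)
        linarith
      · have h1 := hle (reflAt e μ y) (by linarith)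
        rw [reflAt_reflAt he] at h1
        rw [hTzero y hy.le]
        linarith
    have hcomp : ∀ q : Rd d → ℝ, Integrable q → Integrable fun y => q (reflAt e μ y) :=
      fun q hq => (hmp.integrable_comp_emb hemb).2 hq
    have h1 := integral_mono (hhi.add (hcomp h hhi)) (hTi.add (hcomp T hTi)) hle'
    simp only [Pi.add_apply] at h1
    rw [integral_add hhi (hcomp h hhi), integral_add hTi (hcomp T hTi),
      hmp.integral_comp hemb h, hmp.integral_comp hemb T, hTint] at h1
    linarith
  have hlim : Tendsto (fun ρ => J * (volume (ball x ρ)).toReal) (𝓝[>] 0) (𝓝 (J * 0)) := by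
    refine Tendsto.const_mul _ ?_
    have := (ENNReal.tendsto_toReal ENNReal.zero_ne_top).comp (tendsto_measure_ball_zero hd x)
    simpa [Function.comp_def] using this
  rw [mul_zero] at hlim
  have hpos : 0 < min ρ₀ (min D c) := by positivity
  have := ge_of_tendsto hlim (by
    filter_upwards [Ioo_mem_nhdsGT hpos] with ρ hρ using key ρ hρ.1 hρ.2)
  linarith

end Antisymmetric

/-- **Lemma 4.1** (start of the moving plane method in exterior domains): in
the setting of Theorem 2.3, `(S_λ)` holds for all sufficiently large `λ`:
`v_μ = u − u∘R_{μ,e} > 0` in `D_μ = H^μ∖(G ∪ R_{μ,e}(G))` for every `μ ≥ Λ`. -/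
theorem moving_plane_start
    {d : ℕ} (hd : 2 ≤ d) (S : PsiSetting d) (hker : S.kernelCond)
    (V : ℝ → ℝ) (hV : IsRenewal S.Ψ V)
    (n : ℕ) (hn : 0 < n) (G : Fin n → Set (Rd d))
    (hGc : ∀ k, IsCompact (G k)) (hGconn : ∀ k, IsConnected (G k))
    (hGC2 : ∀ k, HasC2BoundaryClosed (G k))
    (hGdisj : ∀ k l, k ≠ l → Disjoint (G k) (G l))
    (A : ℝ) (hA : 0 < A)
    (f : ℝ → ℝ) (hf : ∃ L : ℝ≥0, LipschitzOnWith L f (Set.Icc 0 A))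
    (f₀ : ℝ) (hf₀ : 0 < f₀ ∧ f₀ ≤ A) (hmono : AntitoneOn f (Set.Icc 0 f₀))
    (Ak : Fin n → ℝ) (hAk : ∀ k, Ak k ≤ 0)
    (u : Rd d → ℝ)
    (β : ℝ) (hβ : 0 < β ∧ β < 1)
    (hHolder : ∃ C > (0:ℝ), ∀ x y, |u x - u y| ≤ C * ‖x - y‖ ^ β)
    (hsol : IsSol S ((⋃ k, G k)ᶜ) (fun _ => 0) (fun x => f (u x)) u)
    (hG : ∀ x ∈ ⋃ k, G k, u x = A)
    (htr : ∀ k, ∀ x ∈ frontier (G k),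
      HasVTrace V ((⋃ k, G k)ᶜ) (fun z => u z - A) x (Ak k))
    (hbound : ∀ x ∉ ⋃ k, G k, 0 ≤ u x ∧ u x < A)
    (hdecay : Filter.Tendsto u (Filter.cocompact (Rd d)) (nhds 0))
    (e : Rd d) (he : ‖e‖ = 1)
    :
    ∃ Λ : ℝ, ∀ μ : ℝ, Λ ≤ μ → ∀ x : Rd d, ⟪x, e⟫ < μ →
      x ∉ (⋃ k, G k) → x ∉ reflAt e μ '' (⋃ k, G k) →
      0 < u x - u (reflAt e μ x) := by
  obtain ⟨L, hL⟩ := hf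
  obtain ⟨C, -, hC⟩ := hHolder
  set K : Set (Rd d) := ⋃ k, G k
  have hKc : IsCompact K := isCompact_iUnion hGc
  obtain ⟨p, hp⟩ := (hGconn ⟨0, hn⟩).nonempty
  have hpK : p ∈ K := mem_iUnion.2 ⟨_, hp⟩
  obtain ⟨M₀, hM₀⟩ := hKc.isBounded.exists_norm_le
  have hsmall : ∀ᶠ x in cocompact (Rd d), u x < f₀ := hdecay.eventually_lt_const hf₀.1
  rw [← Metric.cobounded_eq_cocompact, ← comap_norm_atTop, eventually_comap] at hsmall
  obtain ⟨M₁, hM₁⟩ := eventually_atTop.1 hsmall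
  have hu0 : ∀ x, u x ∈ Icc 0 A := by
    intro x
    by_cases hx : x ∈ K
    · rw [hG x hx]
      exact ⟨hA.le, le_rfl⟩
    · exact ⟨(hbound x hx).1, (hbound x hx).2.le⟩
  have huM : ∀ x, |u x| ≤ A := fun x => abs_le.2 ⟨by linarith [(hu0 x).1], (hu0 x).2⟩
  have huc : Continuous u := continuous_iff_lower_upperSemicontinuous.2 ⟨hsol.2.1, hsol.1.1⟩
  have hfu : Continuous fun x => f (u x) := hL.continuousOn.comp_continuous huc hu0
  refine ⟨max M₀ M₁ + 1, fun μ hμ => ?_⟩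
  have hKμ : ∀ y, μ < ⟪y, e⟫ → y ∉ K ∧ u y < f₀ := by
    intro y hy
    have h1 : ⟪y, e⟫ ≤ ‖y‖ := by simpa [he] using real_inner_le_norm y e
    refine ⟨fun h => ?_, hM₁ _ ?_ y rfl⟩
    · linarith [hM₀ y h, le_max_left M₀ M₁]
    · linarith [le_max_right M₀ M₁]
  have hR := continuous_reflAt (e := e) μ
  have hRout : ∀ y, ⟪y, e⟫ < μ → μ < ⟪reflAt e μ y, e⟫ := by
    intro y hy
    rw [inner_reflAt he]
    linarith
  set v : Rd d → ℝ := fun x => u x - u (reflAt e μ x) with hv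
  have hvc : Continuous v := huc.sub (huc.comp hR)
  have hvM : ∀ y, |v y| ≤ 2 * A := by
    intro y
    refine (abs_sub _ _).trans ?_
    linarith [huM y, huM (reflAt e μ y)]
  have hanti : ∀ y, v (reflAt e μ y) = -v y := by
    intro y
    simp only [hv, reflAt_reflAt he]
    ring
  have hplane : ∀ y, ⟪y, e⟫ = μ → v y = 0 := by
    intro y hy
    simp only [hv, reflAt_of_inner_eq hy, sub_self]
  have hvK : ∀ y ∈ K, ⟪y, e⟫ < μ → 0 < v y := by
    intro y hy hyμ
    simp only [hv, hG y hy]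
    exact sub_pos.2 (hbound _ (hKμ _ (hRout y hyμ)).1).2
  have hpμ : ⟪p, e⟫ < μ := by
    have h1 : ⟪p, e⟫ ≤ ‖p‖ := by simpa [he] using real_inner_le_norm p e
    linarith [hM₀ p hpK, le_max_left M₀ M₁]
  by_contra! hcon
  obtain ⟨x, hx, -, -, hvx⟩ := hcon
  obtain ⟨x₀, hx₀, hvx₀, hmin⟩ : ∃ x₀, ⟪x₀, e⟫ < μ ∧ v x₀ ≤ 0 ∧ ∀ y, ⟪y, e⟫ < μ → v x₀ ≤ v y := by
    by_cases hneg : ∃ y, ⟪y, e⟫ < μ ∧ v y < 0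
    · obtain ⟨y₀, hy₀, hvy₀⟩ := hneg
      have hcl : IsClosed {y : Rd d | ⟪y, e⟫ ≤ μ} :=
        isClosed_le (continuous_id.inner continuous_const) continuous_const
      have hv0 : Tendsto v (cocompact (Rd d)) (𝓝 0) := by
        have h := hdecay.sub
          (hdecay.comp (reflHomeo he μ).isClosedEmbedding.tendsto_cocompact)
        rwa [sub_zero] at h
      obtain ⟨x₀, hx₀, hmin⟩ := hvc.continuousOn.exists_isMinOn' hcl (x₀ := y₀) hy₀.le
        ((hv0.eventually_const_le hvy₀).filter_mono inf_le_left)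
      have hneg := (hmin hy₀.le).trans_lt hvy₀
      exact ⟨x₀, lt_of_le_of_ne hx₀ fun h => hneg.ne (hplane x₀ h), hneg.le,
        fun y hy => hmin hy.le⟩
    · push Not at hneg
      exact ⟨x, hx, hvx, fun y hy => hvx.trans (hneg y hy)⟩
  have hx₀K : x₀ ∉ K := fun h => hvx₀.not_gt (hvK x₀ h hx₀)
  have hopen : IsOpen ({y : Rd d | ⟪y, e⟫ < μ} ∩ Kᶜ) :=
    (isOpen_lt (continuous_id.inner continuous_const) continuous_const).inter
      hKc.isClosed.isOpen_compl
  obtain ⟨r, hr, hball⟩ := Metric.nhds_basis_closedBall.mem_iff.1 (hopen.mem_nhds ⟨hx₀, hx₀K⟩)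
  refine false_of_antisymm_min hd S he hvc hvM hanti hx₀ hvx₀ hmin hpμ
    (hvx₀.trans_lt (hvK p hpK hpμ)) (ρ₀ := min (r / 2) 1) (by positivity) fun ρ hρ hρr => ?_
  rw [lt_min_iff] at hρr
  have hmain := sub_le_integral_of_isMin hd S.isLevyDensity huc (huc.comp hR) huM
    (fun y => huM (reflAt e μ y)) hβ.1
    (fun x y => (hC (reflAt e μ x) (reflAt e μ y)).trans_eq (by rw [norm_reflAt_sub_reflAt he]))
    (F := fun x => 2 * f (u x)) (H := fun x => 2 * f (u (reflAt e μ x)))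
    (continuous_const.mul hfu) (continuous_const.mul (hfu.comp hR))
    (fun y hy φ hφ hφy hle => hsol.2.le_integral (hball hy).2 hφ hφy hle)
    (hsol.1.viscSub_comp_reflAt he μ fun y hy => (hKμ _ (hRout y (hball hy).1)).1)
    (fun y hy => hmin y (hball hy).1) hρ (by linarith) hρr.2.le
  have hsub : ∀ z, secondDiff u x₀ z - secondDiff (u ∘ reflAt e μ) x₀ z = secondDiff v x₀ z := by
    intro z
    simp only [secondDiff, Function.comp, hv]
    ring
  simp only [hsub] at hmain
  refine le_trans ?_ hmain
  have hle : u x₀ ≤ u (reflAt e μ x₀) := sub_nonpos.1 hvx₀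
  have hlt := (hKμ _ (hRout x₀ hx₀)).2
  have := hmono ⟨(hu0 _).1, hle.trans hlt.le⟩ ⟨(hu0 _).1, hlt.le⟩ hle
  linarith
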